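/- Let X = (x_n)_{n∈ℕ} be a subsymmetric basis of a real or complex Banach space X whose fundamental function φ_u[X] has the lower regularity property (LRP). Then: (i) there exists a Dini regularization σ of φ_u[X] with σ and σ* nondecreasing; and (ii) for any such σ, X admits an equivalent norm with respect to which X is isometrically greedy, isometrically bidemocratic, and isometrically subsymmetric, with fundamental function equal to σ. -/

import Mathlib

open scoped BigOperators ENNReal NNReal
open MeasureTheory

noncomputable section

namespace GreedyRenorm

/-! ### Sequence notions.  Sequences are indexed by `ℕ`, understood as defined on the
positive integers, with the convention that the value at `0` is `0` where relevant. -/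

/-- `σ` is nondecreasing (on the positive integers). -/
def MonoFrom1 (σ : ℕ → ℝ) : Prop := ∀ m : ℕ, 1 ≤ m → σ m ≤ σ (m + 1)

/-- The dual sequence `σ*(m) = m / σ(m)` is nondecreasing (on the positive integers). -/
def DualMonoFrom1 (σ : ℕ → ℝ) : Prop :=
  ∀ m : ℕ, 1 ≤ m → (m : ℝ) / σ m ≤ ((m : ℝ) + 1) / σ (m + 1)

/-- Lower regularity property: `σ (r m) ≥ 2 σ m` for some positive integer `r`. -/
def HasLRP (σ : ℕ → ℝ) : Prop :=
  ∃ r : ℕ, 1 ≤ r ∧ ∀ m : ℕ, 1 ≤ m → 2 * σ m ≤ σ (r * m)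

/-- Upper regularity property: `σ (r m) ≤ (r/2) σ m` for some positive integer `r`. -/
def HasURP (σ : ℕ → ℝ) : Prop :=
  ∃ r : ℕ, 1 ≤ r ∧ ∀ m : ℕ, 1 ≤ m → σ (r * m) ≤ ((r : ℝ) / 2) * σ m

/-- Dini regularity: the discrete derivative of `σ` is equivalent to `σ(m)/m`. -/
def DiniRegular (σ : ℕ → ℝ) : Prop :=
  ∃ C : ℝ, 1 ≤ C ∧ ∀ m : ℕ, 1 ≤ m →
    (1 / C) * (σ m / (m : ℝ)) ≤ σ m - σ (m - 1) ∧
      σ m - σ (m - 1) ≤ C * (σ m / (m : ℝ))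

/-- `σ` and `τ` are equivalent sequences (on the positive integers). -/
def EquivSeq (σ τ : ℕ → ℝ) : Prop :=
  ∃ D : ℝ, 1 ≤ D ∧ ∀ m : ℕ, 1 ≤ m → (1 / D) * τ m ≤ σ m ∧ σ m ≤ D * τ m

/-- `σ` is a Dini regularization of `τ`: it is Dini-regular and equivalent to `τ`
(with the convention `σ 0 = 0`). -/
def DiniRegularization (σ τ : ℕ → ℝ) : Prop :=
  σ 0 = 0 ∧ DiniRegular σ ∧ EquivSeq σ τ

/-- A Dini regularization of `τ` which is positive and such that both it and its dual
sequence are nondecreasing. -/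
def GoodDiniReg (σ τ : ℕ → ℝ) : Prop :=
  DiniRegularization σ τ ∧ (∀ m : ℕ, 1 ≤ m → 0 < σ m) ∧ MonoFrom1 σ ∧ DualMonoFrom1 σ

/-! ### Fundamental functions and norms -/

/-- The fundamental function of a family `y` computed with respect to a gauge `ν`:
`m ↦ sup { ν (∑_{n ∈ A} ε n • y n) : |A| ≤ m, |ε n| = 1 }`. -/
def fundFunWith (𝕜 : Type*) [RCLike 𝕜] {N Y : Type*} [AddCommGroup Y] [Module 𝕜 Y]
    (ν : Y → ℝ) (y : N → Y) (m : ℕ) : ℝ :=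
  sSup {r : ℝ | ∃ (A : Finset N) (ε : N → 𝕜), A.card ≤ m ∧ (∀ n, ‖ε n‖ = 1) ∧
    r = ν (∑ n ∈ A, ε n • y n)}

/-- The fundamental function of a family `y` in a normed space. -/
def fundFun (𝕜 : Type*) [RCLike 𝕜] {N Y : Type*} [SeminormedAddCommGroup Y]
    [NormedSpace 𝕜 Y] (y : N → Y) (m : ℕ) : ℝ :=
  fundFunWith 𝕜 (fun v => ‖v‖) y m

/-- `ν` is an equivalent norm on the normed space `X`. -/
structure IsEquivNorm (𝕜 : Type*) [RCLike 𝕜] {X : Type*} [NormedAddCommGroup X]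
    [NormedSpace 𝕜 X] (ν : X → ℝ) : Prop where
  add_le : ∀ f g : X, ν (f + g) ≤ ν f + ν g
  smul_eq : ∀ (a : 𝕜) (f : X), ν (a • f) = ‖a‖ * ν f
  lower : ∃ c : ℝ, 0 < c ∧ ∀ f : X, c * ‖f‖ ≤ ν f
  upper : ∃ C : ℝ, 0 < C ∧ ∀ f : X, ν f ≤ C * ‖f‖

section Basis

variable {𝕜 : Type*} [RCLike 𝕜] {N : Type*} {X : Type*}
  [NormedAddCommGroup X] [NormedSpace 𝕜 X]

/-- The dual norm, relative to the gauge `ν` on `X`, of a functional `g`. -/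
def dualNormWith (ν : X → ℝ) (g : X →L[𝕜] 𝕜) : ℝ :=
  sSup {r : ℝ | ∃ f : X, ν f ≤ 1 ∧ r = ‖g f‖}

/-- The fundamental function of the dual system `xs`, computed with the dual norm of `ν`. -/
def dualFundFunWith (ν : X → ℝ) (xs : N → X →L[𝕜] 𝕜) (m : ℕ) : ℝ :=
  sSup {r : ℝ | ∃ (B : Finset N) (δ : N → 𝕜), B.card ≤ m ∧ (∀ n, ‖δ n‖ = 1) ∧
    r = dualNormWith ν (∑ n ∈ B, δ n • xs n)}

/-- `A` is a greedy set of `f` with respect to the coordinate functionals `xs`. -/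
def GreedySet (xs : N → X →L[𝕜] 𝕜) (f : X) (A : Finset N) : Prop :=
  ∀ n ∈ A, ∀ k, k ∉ A → ‖xs k f‖ ≤ ‖xs n f‖

/-- `S_A(f) = ∑_{n ∈ A} x_n^*(f) • x_n`. -/
def greedyProj (x : N → X) (xs : N → X →L[𝕜] 𝕜) (A : Finset N) (f : X) : X :=
  ∑ n ∈ A, xs n f • x n

/-- A complete minimal system with its (biorthogonal) dual system. -/
structure IsCompleteMinimal (x : N → X) (xs : N → X →L[𝕜] 𝕜) : Prop where
  dense_span : (Submodule.span 𝕜 (Set.range x)).topologicalClosure = ⊤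
  biorth_diag : ∀ n, xs n (x n) = 1
  biorth_off : ∀ n k, n ≠ k → xs n (x k) = 0

/-- A basis: a complete minimal system which is semi-normalized and `M`-bounded. -/
structure IsBasis (x : N → X) (xs : N → X →L[𝕜] 𝕜) : Prop where
  dense_span : (Submodule.span 𝕜 (Set.range x)).topologicalClosure = ⊤
  biorth_diag : ∀ n, xs n (x n) = 1
  biorth_off : ∀ n k, n ≠ k → xs n (x k) = 0
  norm_pos : ∃ c : ℝ, 0 < c ∧ ∀ n, c ≤ ‖x n‖
  norm_bdd : ∃ C : ℝ, ∀ n, ‖x n‖ ≤ C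
  mBounded : ∃ C : ℝ, ∀ n, ‖x n‖ * ‖xs n‖ ≤ C

/-- The basis is `C`-greedy with respect to the gauge `ν`. -/
def GreedyWith (ν : X → ℝ) (x : N → X) (xs : N → X →L[𝕜] 𝕜) (C : ℝ) : Prop :=
  ∀ (f : X) (A B : Finset N) (a : N → 𝕜), GreedySet xs f A → B.card ≤ A.card →
    ν (f - greedyProj x xs A f) ≤ C * ν (f - ∑ n ∈ B, a n • x n)

/-- The basis is `C`-almost greedy with respect to the gauge `ν`. -/
def AlmostGreedyWith (ν : X → ℝ) (x : N → X) (xs : N → X →L[𝕜] 𝕜) (C : ℝ) : Prop :=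
  ∀ (f : X) (A B : Finset N), GreedySet xs f A → B.card ≤ A.card →
    ν (f - greedyProj x xs A f) ≤ C * ν (f - greedyProj x xs B f)

/-- The basis is `C`-quasi-greedy with respect to the gauge `ν`. -/
def QuasiGreedyWith (ν : X → ℝ) (x : N → X) (xs : N → X →L[𝕜] 𝕜) (C : ℝ) : Prop :=
  ∀ (f : X) (A : Finset N), GreedySet xs f A → ν (greedyProj x xs A f) ≤ C * ν f

/-- The basis is lattice `C`-unconditional with respect to the gauge `ν`. -/
def LatticeUnconditionalWith (ν : X → ℝ) (x : N → X) (xs : N → X →L[𝕜] 𝕜) (C : ℝ) : Prop :=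
  ∀ (f : X) (A : Finset N) (lam : N → 𝕜) (M : ℝ), (∀ n, ‖lam n‖ ≤ M) →
    ν (∑ n ∈ A, lam n • xs n f • x n) ≤ C * M * ν f

/-- The basis is suppression `C`-unconditional (with respect to the ambient norm). -/
def SuppressionUnconditional (x : N → X) (xs : N → X →L[𝕜] 𝕜) (C : ℝ) : Prop :=
  ∀ (f : X) (A : Finset N), ‖greedyProj x xs A f‖ ≤ C * ‖f‖

/-- The family `x` is `C`-democratic (with respect to the ambient norm). -/
def Democratic (x : N → X) (C : ℝ) : Prop :=
  ∀ A B : Finset N, A.card ≤ B.card → ‖∑ n ∈ A, x n‖ ≤ C * ‖∑ n ∈ B, x n‖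

/-- The basis is `C`-bidemocratic (with respect to the ambient norm; the dual system
carries the operator norm). -/
def Bidemocratic (x : N → X) (xs : N → X →L[𝕜] 𝕜) (C : ℝ) : Prop :=
  ∀ (A B : Finset N) (ε δ : N → 𝕜), (∀ n, ‖ε n‖ = 1) → (∀ n, ‖δ n‖ = 1) →
    ‖∑ n ∈ A, ε n • x n‖ * ‖∑ n ∈ B, δ n • xs n‖ ≤ C * (max A.card B.card : ℕ)

/-- The basis is `C`-bidemocratic with respect to the gauge `ν` (the dual system carries
the corresponding dual norm). -/
def BidemocraticWith (ν : X → ℝ) (x : N → X) (xs : N → X →L[𝕜] 𝕜) (C : ℝ) : Prop :=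
  ∀ (A B : Finset N) (ε δ : N → 𝕜), (∀ n, ‖ε n‖ = 1) → (∀ n, ‖δ n‖ = 1) →
    ν (∑ n ∈ A, ε n • x n) * dualNormWith ν (∑ n ∈ B, δ n • xs n) ≤
      C * (max A.card B.card : ℕ)

/-- Property (A) with respect to the gauge `ν`. -/
def PropertyAWith (ν : X → ℝ) (x : N → X) (xs : N → X →L[𝕜] 𝕜) : Prop :=
  ∀ (A B : Finset N) (ε δ : N → 𝕜) (g : X),
    A.card ≤ B.card → Disjoint A B → (∀ n, ‖ε n‖ = 1) → (∀ n, ‖δ n‖ = 1) →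
    (∀ n, (n ∈ A ∨ n ∈ B) → xs n g = 0) → (∀ n, ‖xs n g‖ ≤ 1) →
    ν ((∑ n ∈ A, ε n • x n) + g) ≤ ν ((∑ n ∈ B, δ n • x n) + g)

end Basis

/-- The basis `x` (indexed by `ℕ`) is `C`-subsymmetric with respect to the gauge `ν`:
every "dilated sign change" extends to an isomorphism onto its range with distortion
constants at most `C`. -/
def SubsymWith (𝕜 : Type*) [RCLike 𝕜] {X : Type*} [NormedAddCommGroup X]
    [NormedSpace 𝕜 X] (ν : X → ℝ) (x : ℕ → X) (C : ℝ) : Prop :=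
  ∀ (lam : ℕ → 𝕜), (∀ n, ‖lam n‖ = 1) → ∀ β : ℕ → ℕ, StrictMono β →
    ∃ T : X →L[𝕜] X, (∀ n, T (x n) = lam n • x (β n)) ∧
      (∀ f : X, ν (T f) ≤ C * ν f) ∧ (∀ f : X, ν f ≤ C * ν (T f))

/-- `X` has nontrivial Rademacher cotype. -/
def NontrivialCotype (X : Type*) [SeminormedAddCommGroup X] : Prop :=
  ∃ q C : ℝ, 0 < q ∧ 0 < C ∧ ∀ (n : ℕ) (f : Fin n → X),
    (∑ i, ‖f i‖ ^ q) ^ (1 / q) ≤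
      C * (((2 : ℝ) ^ n)⁻¹ * ∑ ε : Fin n → Bool, ‖∑ i, (if ε i then f i else -f i)‖)

/-- `X` has nontrivial Rademacher type. -/
def NontrivialType (X : Type*) [SeminormedAddCommGroup X] : Prop :=
  ∃ p C : ℝ, 1 < p ∧ 0 < C ∧ ∀ (n : ℕ) (f : Fin n → X),
    ((2 : ℝ) ^ n)⁻¹ * ∑ ε : Fin n → Bool, ‖∑ i, (if ε i then f i else -f i)‖ ≤
      C * (∑ i, ‖f i‖ ^ p) ^ (1 / p)

end GreedyRenorm
namespace GreedyRenorm

/-! ### Fundamental functions -/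

section FundamentalFunction

variable {𝕜 : Type*} [RCLike 𝕜] {X : Type*} [NormedAddCommGroup X] [NormedSpace 𝕜 X]

lemma le_fundFun {x : ℕ → X} {C : ℝ} (hC : ∀ n, ‖x n‖ ≤ C) {m : ℕ} {A : Finset ℕ}
    {ε : ℕ → 𝕜} (hA : A.card ≤ m) (hε : ∀ n, ‖ε n‖ = 1) :
    ‖∑ n ∈ A, ε n • x n‖ ≤ fundFun 𝕜 x m := by
  have hC0 : 0 ≤ C := (norm_nonneg _).trans (hC 0)
  refine le_csSup ⟨m * C, ?_⟩ ⟨A, ε, hA, hε, rfl⟩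
  rintro r ⟨B, δ, hB, hδ, rfl⟩
  calc ‖∑ n ∈ B, δ n • x n‖ ≤ ∑ n ∈ B, C :=
        norm_sum_le_of_le _ fun n _ => by rw [norm_smul, hδ, one_mul]; exact hC n
    _ = B.card * C := by simp
    _ ≤ m * C := by gcongr

lemma fundFun_le {x : ℕ → X} {m : ℕ} {b : ℝ}
    (h : ∀ (A : Finset ℕ) (ε : ℕ → 𝕜), A.card ≤ m → (∀ n, ‖ε n‖ = 1) →
      ‖∑ n ∈ A, ε n • x n‖ ≤ b) :
    fundFun 𝕜 x m ≤ b := by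
  refine csSup_le ⟨_, ∅, fun _ => 1, by simp, by simp, rfl⟩ ?_
  rintro r ⟨A, ε, hA, hε, rfl⟩
  exact h A ε hA hε

lemma fundFun_pos {x : ℕ → X} {c C : ℝ} (hc : 0 < c) (hc' : ∀ n, c ≤ ‖x n‖)
    (hC : ∀ n, ‖x n‖ ≤ C) {m : ℕ} (hm : 1 ≤ m) : 0 < fundFun 𝕜 x m := by
  have h := le_fundFun (𝕜 := 𝕜) hC (m := m) (A := {0}) (ε := fun _ => 1) (by simpa using hm)
    (by simp)
  have := hc' 0
  simp at h
  linarith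

lemma fundFun_monotone {x : ℕ → X} {C : ℝ} (hC : ∀ n, ‖x n‖ ≤ C) : Monotone (fundFun 𝕜 x) :=
  fun _ _ hmk => fundFun_le fun _ _ hA hε => le_fundFun hC (hA.trans hmk) hε

lemma fundFun_div_succ_le {x : ℕ → X} {C : ℝ} (hC : ∀ n, ‖x n‖ ≤ C) {m : ℕ} (hm : 1 ≤ m) :
    fundFun 𝕜 x (m + 1) / ((m : ℝ) + 1) ≤ fundFun 𝕜 x m / m := by
  have hm0 : (0 : ℝ) < m := by exact_mod_cast hm
  have hnn : 0 ≤ fundFun 𝕜 x m :=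
    (norm_nonneg _).trans (le_fundFun (𝕜 := 𝕜) hC (A := ∅) (ε := fun _ => 1) (by simp) (by simp))
  rw [div_le_iff₀ (by positivity)]
  refine fundFun_le fun A ε hA hε => ?_
  rcases Nat.lt_or_ge m A.card with h | h
  · have hcard : A.card = m + 1 := le_antisymm hA h
    have key : (m : 𝕜) • ∑ n ∈ A, ε n • x n = ∑ a ∈ A, ∑ n ∈ A.erase a, ε n • x n := by
      have : ∀ a ∈ A, ∑ n ∈ A.erase a, ε n • x n = (∑ n ∈ A, ε n • x n) - ε a • x a :=
        fun a ha => by rw [← Finset.sum_erase_add A _ ha]; simp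
      rw [Finset.sum_congr rfl this, Finset.sum_sub_distrib, Finset.sum_const, hcard,
        add_smul, one_smul, add_sub_cancel_right, Nat.cast_smul_eq_nsmul]
    have h2 : ‖(m : 𝕜) • ∑ n ∈ A, ε n • x n‖ ≤ (m + 1) * fundFun 𝕜 x m := by
      rw [key]
      calc _ ≤ ∑ a ∈ A, fundFun 𝕜 x m := norm_sum_le_of_le _ fun a ha =>
            le_fundFun hC (by rw [Finset.card_erase_of_mem ha, hcard]; simp) hε
        _ = _ := by simp [hcard]
    rw [norm_smul, RCLike.norm_natCast] at h2
    rw [div_mul_eq_mul_div, le_div_iff₀ hm0]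
    linarith
  · refine (le_fundFun hC h hε).trans ?_
    rw [div_mul_eq_mul_div, le_div_iff₀ hm0]
    nlinarith

end FundamentalFunction

/-! ### Existence of a Dini regularization -/

lemma sum_div_le_of_hasLRP {φ : ℕ → ℝ} (hpos : ∀ m, 1 ≤ m → 0 < φ m) (hmono : Monotone φ)
    {r : ℕ} (hr : 2 ≤ r) (h : ∀ m : ℕ, 1 ≤ m → 2 * φ m ≤ φ (r * m)) (m : ℕ) (hm : 1 ≤ m) :
    ∑ n ∈ Finset.range m, φ (n + 1) / ((n : ℝ) + 1) ≤ 4 * r * φ m := by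
  induction m using Nat.strong_induction_on with
  | _ m ih =>
    have hφ := hpos m hm
    rcases Nat.lt_or_ge m r with hmr | hmr
    · have hmr' : (m : ℝ) ≤ r := by exact_mod_cast hmr.le
      calc _ ≤ ∑ n ∈ Finset.range m, φ m := by
            refine Finset.sum_le_sum fun n hn => ?_
            have h1 : φ (n + 1) ≤ φ m := hmono (by simpa using hn)
            rw [div_le_iff₀ (by positivity)]
            nlinarith [(Nat.cast_nonneg n : (0 : ℝ) ≤ n)]
        _ = m * φ m := by simp
        _ ≤ _ := by nlinarith
    · set k := m / r with hk
      have hk1 : 1 ≤ k := (Nat.one_le_div_iff (by omega)).2 hmr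
      have hkm : k < m := Nat.div_lt_self (by omega) hr
      have hrk : r * k ≤ m := Nat.mul_div_le m r
      have hrk' : m < r * (k + 1) := by
        rw [hk]
        exact Nat.lt_mul_div_succ m (by omega)
      have hm2 : (m : ℝ) ≤ 2 * r * k := by
        have : m ≤ 2 * r * k := by nlinarith
        exact_mod_cast this
      have hk0 : (0 : ℝ) < k := by exact_mod_cast hk1
      rw [← Finset.sum_range_add_sum_Ico _ hkm.le]
      have h1 := ih k hkm hk1
      have h2 : ∑ n ∈ Finset.Ico k m, φ (n + 1) / ((n : ℝ) + 1) ≤ 2 * r * φ m := by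
        calc _ ≤ ∑ n ∈ Finset.Ico k m, φ m / k := by
              refine Finset.sum_le_sum fun n hn => ?_
              rw [Finset.mem_Ico] at hn
              have hkn : (k : ℝ) ≤ n := by exact_mod_cast hn.1
              exact div_le_div₀ hφ.le (hmono hn.2) hk0 (by linarith)
          _ = (m - k : ℕ) * (φ m / k) := by simp
          _ ≤ (2 * r * k) * (φ m / k) := by
              gcongr
              exact le_trans (by exact_mod_cast Nat.sub_le m k) hm2
          _ = _ := by field_simp
      have h3 : 2 * φ k ≤ φ m := (h k hk1).trans (hmono hrk)
      have hr0 : (0 : ℝ) ≤ r := Nat.cast_nonneg r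
      nlinarith

lemma exists_goodDiniReg {φ : ℕ → ℝ} (hpos : ∀ m, 1 ≤ m → 0 < φ m) (hmono : Monotone φ)
    (hdual : ∀ m : ℕ, 1 ≤ m → φ (m + 1) / ((m : ℝ) + 1) ≤ φ m / m) (hlrp : HasLRP φ) :
    ∃ σ : ℕ → ℝ, GoodDiniReg σ φ := by
  obtain ⟨r, hr1, hr⟩ := hlrp
  have hr2 : 2 ≤ r := by
    by_contra! hlt
    obtain rfl : r = 1 := by omega
    have h1 := hr 1 le_rfl
    have h2 := hpos 1 le_rfl
    norm_num at h1
    linarith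
  set σ : ℕ → ℝ := fun m => ∑ n ∈ Finset.range m, φ (n + 1) / ((n : ℝ) + 1) with hσ
  have hsucc : ∀ m, σ (m + 1) = σ m + φ (m + 1) / ((m : ℝ) + 1) := fun m =>
    Finset.sum_range_succ _ _
  have hup : ∀ m, 1 ≤ m → σ m ≤ 4 * r * φ m := sum_div_le_of_hasLRP hpos hmono hr2 hr
  have hanti : ∀ n m : ℕ, 1 ≤ n → n ≤ m → φ m / m ≤ φ n / n := by
    intro n m hn hnm
    induction m, hnm using Nat.le_induction with
    | base => exact le_rfl
    | succ k hk ih => exact (by exact_mod_cast hdual k (hn.trans hk) :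
        φ (k + 1) / ((k + 1 : ℕ) : ℝ) ≤ φ k / k).trans ih
  have hlow : ∀ m, 1 ≤ m → φ m ≤ σ m := by
    intro m hm
    have hm0 : (0 : ℝ) < m := by exact_mod_cast hm
    calc φ m = ∑ n ∈ Finset.range m, φ m / m := by simp; field_simp
      _ ≤ σ m := Finset.sum_le_sum fun n hn => by
        have := hanti (n + 1) m (by omega) (by simpa using hn)
        exact_mod_cast this
  have hr0 : (2 : ℝ) ≤ r := by exact_mod_cast hr2
  have hC1 : (1 : ℝ) ≤ 4 * r := by linarith
  have hσpos : ∀ m, 1 ≤ m → 0 < σ m := fun m hm => (hpos m hm).trans_le (hlow m hm)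
  refine ⟨σ, ⟨by simp [hσ], ⟨4 * r, hC1, fun m hm => ?_⟩, ⟨4 * r, hC1, fun m hm => ⟨?_, hup m hm⟩⟩⟩,
    hσpos, fun m hm => ?_, fun m hm => ?_⟩
  · obtain ⟨k, rfl⟩ : ∃ k, m = k + 1 := ⟨m - 1, by omega⟩
    have hdiff : σ (k + 1) - σ (k + 1 - 1) = φ (k + 1) / ((k + 1 : ℕ) : ℝ) := by
      rw [Nat.add_sub_cancel, hsucc]; push_cast; ring
    have hk0 : (0 : ℝ) < (k + 1 : ℕ) := by positivity
    rw [hdiff]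
    constructor
    · rw [← mul_div_assoc]
      gcongr
      rw [one_div, inv_mul_le_iff₀ (by linarith)]
      exact hup _ hm
    · rw [← mul_div_assoc]
      gcongr
      nlinarith [hlow _ hm, hσpos _ hm]
  · refine le_trans ?_ (hlow m hm)
    rw [one_div, inv_mul_le_iff₀ (by linarith)]
    nlinarith [hpos m hm]
  · rw [hsucc]
    have := hpos (m + 1) (by omega)
    have : 0 < φ (m + 1) / ((m : ℝ) + 1) := by positivity
    linarith
  · have hm0 : (0 : ℝ) < m := by exact_mod_cast hm
    rw [div_le_div_iff₀ (hσpos m hm) (hσpos (m + 1) (by omega)), hsucc]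
    have h1 : (m : ℝ) * (φ (m + 1) / ((m : ℝ) + 1)) ≤ σ m := by
      calc _ ≤ (m : ℝ) * (φ m / m) := mul_le_mul_of_nonneg_left (hdual m hm) hm0.le
        _ = φ m := by field_simp
        _ ≤ _ := hlow m hm
    nlinarith

/-! ### Subsymmetric bases -/

section Subsymmetric

variable {𝕜 : Type*} [RCLike 𝕜] {X : Type*} [NormedAddCommGroup X] [NormedSpace 𝕜 X]
  {x : ℕ → X} {xs : ℕ → X →L[𝕜] 𝕜}

lemma IsBasis.dense (hb : IsBasis x xs) :
    Dense (Submodule.span 𝕜 (Set.range x) : Set X) :=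
  Submodule.dense_iff_topologicalClosure_eq_top.2 hb.dense_span

lemma IsBasis.clm_ext (hb : IsBasis x xs) {Y : Type*} [NormedAddCommGroup Y] [NormedSpace 𝕜 Y]
    {S T : X →L[𝕜] Y} (h : ∀ n, S (x n) = T (x n)) : S = T :=
  ContinuousLinearMap.ext_on hb.dense (by rintro _ ⟨n, rfl⟩; exact h n)

lemma IsBasis.coord_apply (hb : IsBasis x xs) (n k : ℕ) : xs n (x k) = if n = k then 1 else 0 := by
  split_ifs with h
  · rw [h, hb.biorth_diag]
  · exact hb.biorth_off n k h

lemma IsBasis.coord_sum (hb : IsBasis x xs) (A : Finset ℕ) (a : ℕ → 𝕜) (n : ℕ) :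
    xs n (∑ k ∈ A, a k • x k) = if n ∈ A then a n else 0 := by
  simp [map_sum, hb.coord_apply]

lemma IsBasis.coord_map (hb : IsBasis x xs) {lam : ℕ → 𝕜} {β : ℕ → ℕ}
    (hβ : Function.Injective β) {T : X →L[𝕜] X} (hT : ∀ n, T (x n) = lam n • x (β n))
    (n : ℕ) (f : X) : xs (β n) (T f) = lam n * xs n f := by
  have : (xs (β n)).comp T = lam n • xs n := hb.clm_ext fun k => by
    by_cases h : n = k
    · simp [hT, hb.coord_apply, h]
    · simp [hT, hb.coord_apply, h, hβ.eq_iff]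
  simpa using congrArg (fun L : X →L[𝕜] 𝕜 => L f) this

lemma IsBasis.coord_map_of_notMem (hb : IsBasis x xs) {lam : ℕ → 𝕜} {β : ℕ → ℕ}
    {T : X →L[𝕜] X} (hT : ∀ n, T (x n) = lam n • x (β n))
    {k : ℕ} (hk : k ∉ Set.range β) (f : X) : xs k (T f) = 0 := by
  have : (xs k).comp T = 0 := hb.clm_ext fun n => by
    have : k ≠ β n := fun h => hk ⟨n, h.symm⟩
    simp [hT, hb.coord_apply, this]
  simpa using congrArg (fun L : X →L[𝕜] 𝕜 => L f) this

lemma IsBasis.norm_sum_coord_le (hb : IsBasis x xs) {C : ℝ}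
    (hss : SubsymWith 𝕜 (fun f : X => ‖f‖) x C) (A : Finset ℕ) {lam : ℕ → 𝕜}
    (hlam : ∀ n, ‖lam n‖ = 1) (f : X) :
    ‖∑ n ∈ A, lam n • xs n f • x n‖ ≤ C * ‖f‖ := by
  classical
  obtain ⟨S, hS, hS', -⟩ := hss (fun n => if n ∈ A then lam n else 1)
    (fun n => by split_ifs <;> simp [hlam]) id strictMono_id
  obtain ⟨T, hT, hT', -⟩ := hss (fun n => if n ∈ A then -lam n else 1)
    (fun n => by split_ifs <;> simp [hlam]) id strictMono_id
  have key : S - T = (2 : 𝕜) • ∑ n ∈ A, lam n • (xs n).smulRight (x n) := hb.clm_ext fun k => by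
    by_cases hk : k ∈ A
    · simp [hS, hT, hk, hb.coord_apply, ite_smul, two_smul]
    · simp [hS, hT, hk, hb.coord_apply, ite_smul]
  have h1 := congrArg (fun L : X →L[𝕜] X => ‖L f‖) key
  simp only [sub_apply, smul_apply, sum_apply,
    ContinuousLinearMap.smulRight_apply, norm_smul,
    RCLike.norm_ofNat] at h1
  have h2 := norm_sub_le (S f) (T f)
  have h3 := hS' f
  have h4 := hT' f
  linarith

lemma exists_strictMono_extension {A : Finset ℕ} {α β : ℕ → ℕ} (hα : StrictMonoOn α A)
    (hβ : StrictMonoOn β A) :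
    ∃ γ γ' : ℕ → ℕ, StrictMono γ ∧ StrictMono γ' ∧ ∀ i ∈ A, γ (α i) = γ' (β i) := by
  set M : ℕ := A.sup α + 1 with hM
  have hαM : ∀ i ∈ A, α i < M := fun i hi => Nat.lt_succ_of_le (Finset.le_sup hi)
  refine ⟨fun n => n + (A.filter fun i => α i ≤ n).sup fun i => M * (β i + 1) - α i,
    fun n => M * (n + 1), strictMono_nat_of_lt_succ fun n => ?_, fun a b hab => ?_, fun i hi => ?_⟩
  · refine add_lt_add_of_lt_of_le (Nat.lt_succ_self n) (Finset.sup_mono fun i => ?_)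
    simp only [Finset.mem_filter]
    exact fun h => ⟨h.1, h.2.trans (Nat.le_succ n)⟩
  · exact Nat.mul_lt_mul_of_pos_left (by omega) (by omega)
  · have hsup : ((A.filter fun j => α j ≤ α i).sup fun j => M * (β j + 1) - α j)
        = M * (β i + 1) - α i := by
      refine le_antisymm (Finset.sup_le fun j hj => ?_) (Finset.le_sup
        (f := fun j => M * (β j + 1) - α j) (by simp [hi]))
      rw [Finset.mem_filter] at hj
      have hji : j ≤ i := (hα.le_iff_le hj.1 hi).1 hj.2
      rcases hji.eq_or_lt with rfl | hlt
      · exact le_rfl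
      · have h1 : β j + 1 ≤ β i := hβ hj.1 hi hlt
        have h2 : M * (β j + 1) ≤ M * β i := Nat.mul_le_mul_left _ h1
        have h3 := hαM i hi
        rw [Nat.mul_add M (β i) 1]
        omega
    simp only [hsup]
    have h3 := hαM i hi
    rw [Nat.mul_add]
    omega

lemma IsBasis.norm_sum_coord_move_le (hb : IsBasis x xs) {C : ℝ} (hC : 1 ≤ C)
    (hss : SubsymWith 𝕜 (fun f : X => ‖f‖) x C) {A : Finset ℕ} {α β : ℕ → ℕ}
    (hα : StrictMonoOn α A) (hβ : StrictMonoOn β A) {lam : ℕ → 𝕜}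
    (hlam : ∀ n, ‖lam n‖ = 1) (f : X) :
    ‖∑ i ∈ A, lam i • xs (α i) f • x (β i)‖ ≤ C ^ 3 * ‖f‖ := by
  classical
  obtain ⟨γ, γ', hγ, hγ', hγγ⟩ := exists_strictMono_extension hα hβ
  obtain ⟨S, hS, hS', -⟩ := hss (fun _ => 1) (by simp) γ hγ
  obtain ⟨T, hT, -, hT'⟩ := hss (fun _ => 1) (by simp) γ' hγ'
  have hST : T (∑ i ∈ A, lam i • xs (α i) f • x (β i))
      = S (∑ i ∈ A, lam i • xs (α i) f • x (α i)) := by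
    simp only [map_sum, map_smul, hS, hT, one_smul]
    exact Finset.sum_congr rfl fun i hi => by rw [hγγ i hi]
  have hsum : ∑ i ∈ A, lam i • xs (α i) f • x (α i)
      = ∑ n ∈ A.image α, lam (Function.invFunOn α A n) • xs n f • x n := by
    rw [Finset.sum_image hα.injOn]
    exact Finset.sum_congr rfl fun i hi => by
      rw [hα.injOn.leftInvOn_invFunOn hi]
  have h1 := hT' (∑ i ∈ A, lam i • xs (α i) f • x (β i))
  have h2 := hS' (∑ i ∈ A, lam i • xs (α i) f • x (α i))
  have h3 := hb.norm_sum_coord_le hss (A.image α)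
    (lam := fun n => lam (Function.invFunOn α A n)) (fun n => hlam _) f
  simp only at h1 h2
  rw [hST] at h1
  rw [← hsum] at h3
  calc _ ≤ C * (C * (C * ‖f‖)) := by
        refine h1.trans (mul_le_mul_of_nonneg_left (h2.trans ?_) (by linarith))
        exact mul_le_mul_of_nonneg_left h3 (by linarith)
    _ = _ := by ring

lemma exists_norm_one_mul_eq (a : 𝕜) : ∃ u : 𝕜, ‖u‖ = 1 ∧ u * a = (‖a‖ : 𝕜) := by
  by_cases h : a = 0
  · exact ⟨1, by simp, by simp [h]⟩
  · have h' : (‖a‖ : 𝕜) ≠ 0 := by simpa using h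
    refine ⟨(‖a‖ : 𝕜) / a, ?_, by field_simp⟩
    rw [norm_div, RCLike.norm_ofReal, abs_norm, div_self (by simpa using h)]

/-- Order-preserving relabellings of the absolute coefficients of a functional are bounded. -/
lemma IsBasis.sum_norm_mul_norm_coord_le (hb : IsBasis x xs) {C : ℝ} (hC : 1 ≤ C)
    (hss : SubsymWith 𝕜 (fun f : X => ‖f‖) x C) {A : Finset ℕ} {α β : ℕ → ℕ}
    (hα : StrictMonoOn α A) (hβ : StrictMonoOn β A) (F : X →L[𝕜] 𝕜) (hF : ‖F‖ ≤ 1) (f : X) :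
    ∑ i ∈ A, ‖F (x (α i))‖ * ‖xs (β i) f‖ ≤ C ^ 3 * ‖f‖ := by
  choose u hu hu' using fun a : 𝕜 => exists_norm_one_mul_eq a
  have h := hb.norm_sum_coord_move_le hC hss hβ hα
    (lam := fun i => u (xs (β i) f * F (x (α i)))) (fun i => hu _) f
  have h2 : F (∑ i ∈ A, u (xs (β i) f * F (x (α i))) • xs (β i) f • x (α i))
      = ((∑ i ∈ A, ‖F (x (α i))‖ * ‖xs (β i) f‖ : ℝ) : 𝕜) := by
    rw [map_sum]
    push_cast
    refine Finset.sum_congr rfl fun i _ => ?_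
    rw [map_smul, map_smul, smul_eq_mul, smul_eq_mul, hu', norm_mul]
    push_cast
    ring
  have h3 := F.le_of_opNorm_le hF (∑ i ∈ A, u (xs (β i) f * F (x (α i))) • xs (β i) f • x (α i))
  rw [h2, RCLike.norm_ofReal, one_mul] at h3
  exact (le_abs_self _).trans (h3.trans h)

lemma exists_strictMonoOn_image_range (A : Finset ℕ) :
    ∃ β : ℕ → ℕ, StrictMonoOn β (Finset.range A.card) ∧ (Finset.range A.card).image β = A := by
  set e := A.orderEmbOfFin rfl
  set β : ℕ → ℕ := fun i => if h : i < A.card then e ⟨i, h⟩ else 0 with hβdef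
  have hβ : StrictMonoOn β (Finset.range A.card) := by
    intro i hi j hj hij
    simp only [Finset.coe_range, Set.mem_Iio] at hi hj
    simp only [hβdef, hi, hj, dif_pos]
    exact e.strictMono hij
  refine ⟨β, hβ, Finset.eq_of_subset_of_card_le ?_ ?_⟩
  · intro n hn
    obtain ⟨i, hi, rfl⟩ := Finset.mem_image.1 hn
    rw [Finset.mem_range] at hi
    simp only [hβdef, hi, dif_pos]
    exact A.orderEmbOfFin_mem rfl _
  · rw [Finset.card_image_of_injOn hβ.injOn, Finset.card_range]

lemma IsBasis.fundFun_le_norm_sum (hb : IsBasis x xs) {C : ℝ} (hC : 1 ≤ C)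
    (hss : SubsymWith 𝕜 (fun f : X => ‖f‖) x C) {m k : ℕ} :
    fundFun 𝕜 x m ≤ C ^ 3 * ‖∑ j ∈ Finset.Ico k (k + m), x j‖ := by
  refine fundFun_le fun A ε hA hε => ?_
  obtain ⟨β, hβ, himage⟩ := exists_strictMonoOn_image_range A
  have hα : StrictMonoOn (fun i => k + i) (Finset.range A.card) := fun i _ j _ hij =>
    Nat.add_lt_add_left hij k
  have h := hb.norm_sum_coord_move_le hC hss hα hβ (lam := fun i => ε (β i)) (fun i => hε _)
    (∑ j ∈ Finset.Ico k (k + m), x j)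
  have hsum : ∑ n ∈ A, ε n • x n = ∑ i ∈ Finset.range A.card,
      ε (β i) • xs (k + i) (∑ j ∈ Finset.Ico k (k + m), x j) • x (β i) := by
    conv_lhs => rw [← himage, Finset.sum_image hβ.injOn]
    refine Finset.sum_congr rfl fun i hi => ?_
    have hc := hb.coord_sum (Finset.Ico k (k + m)) (fun _ => 1) (k + i)
    simp only [one_smul] at hc
    rw [Finset.mem_range] at hi
    rw [hc, if_pos (by simp; omega), one_smul]
  rw [hsum]
  exact h

/-- Subsymmetric bases are bidemocratic. -/
lemma IsBasis.sum_norm_coord_mul_fundFun_le (hb : IsBasis x xs) {C : ℝ} (hC : 1 ≤ C)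
    (hss : SubsymWith 𝕜 (fun f : X => ‖f‖) x C) (D : Finset ℕ) (f : X) :
    (∑ n ∈ D, ‖xs n f‖) * fundFun 𝕜 x D.card ≤ 2 * C ^ 6 * D.card * ‖f‖ := by
  classical
  obtain ⟨α, hα, himage⟩ := exists_strictMonoOn_image_range D
  set m := D.card
  choose u hu hu' using fun a : 𝕜 => exists_norm_one_mul_eq a
  have hshift : ∀ k, ‖∑ i ∈ (Finset.range m).filter (fun i => i + k ∈ Finset.Ico m (m + m)),
      (‖xs (α i) f‖ : 𝕜) • x (i + k)‖ ≤ C ^ 3 * ‖f‖ := by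
    intro k
    have h := hb.norm_sum_coord_move_le hC hss
      (A := (Finset.range m).filter (fun i => i + k ∈ Finset.Ico m (m + m))) (α := α)
      (β := fun i => i + k) (hα.mono (Finset.coe_subset.2 (Finset.filter_subset _ _)))
      (fun i _ j _ hij => Nat.add_lt_add_right hij k) (lam := fun i => u (xs (α i) f))
      (fun i => hu _) f
    simpa only [smul_smul, hu'] using h
  have htot : ((∑ n ∈ D, ‖xs n f‖ : ℝ) : 𝕜) • ∑ j ∈ Finset.Ico m (m + m), x j
      = ∑ k ∈ Finset.range (2 * m),
        ∑ i ∈ (Finset.range m).filter (fun i => i + k ∈ Finset.Ico m (m + m)),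
          (‖xs (α i) f‖ : 𝕜) • x (i + k) := by
    conv_lhs => rw [← himage, Finset.sum_image hα.injOn]
    push_cast
    rw [Finset.sum_smul]
    simp only [Finset.sum_filter]
    rw [Finset.sum_comm]
    refine Finset.sum_congr rfl fun i hi => ?_
    rw [← Finset.sum_filter, Finset.smul_sum]
    rw [Finset.mem_range] at hi
    refine Finset.sum_bij' (fun j _ => j - i) (fun k _ => i + k) ?_ ?_ ?_ ?_ ?_ <;>
      simp only [Finset.mem_filter, Finset.mem_range, Finset.mem_Ico]
    · intro j hj; omega
    · intro k hk; omega
    · intro j hj; omega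
    · intro j hj; omega
    · intro j hj
      rw [Nat.add_sub_of_le (by omega)]
  have hnorm := congrArg norm htot
  have hS0 : 0 ≤ ∑ n ∈ D, ‖xs n f‖ := Finset.sum_nonneg fun _ _ => norm_nonneg _
  rw [norm_smul, RCLike.norm_ofReal, abs_of_nonneg hS0] at hnorm
  have hle : (∑ n ∈ D, ‖xs n f‖) * ‖∑ j ∈ Finset.Ico m (m + m), x j‖
      ≤ (2 * m) * (C ^ 3 * ‖f‖) := by
    rw [hnorm]
    calc _ ≤ ∑ k ∈ Finset.range (2 * m), C ^ 3 * ‖f‖ := norm_sum_le_of_le _ fun k _ => hshift k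
      _ = _ := by simp
  calc _ ≤ (∑ n ∈ D, ‖xs n f‖) * (C ^ 3 * ‖∑ j ∈ Finset.Ico m (m + m), x j‖) :=
        mul_le_mul_of_nonneg_left (hb.fundFun_le_norm_sum hC hss) hS0
    _ = C ^ 3 * ((∑ n ∈ D, ‖xs n f‖) * ‖∑ j ∈ Finset.Ico m (m + m), x j‖) := by ring
    _ ≤ C ^ 3 * ((2 * m) * (C ^ 3 * ‖f‖)) := by gcongr
    _ = _ := by ring

end Subsymmetric

/-! ### The new norm -/

/-- Positive sequences, nondecreasing along with their duals, whose increments are bounded below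
by `σ m / (C * m)`. -/
structure IsWeight (σ : ℕ → ℝ) (C : ℝ) : Prop where
  zero : σ 0 = 0
  one_le : 1 ≤ C
  pos : ∀ m, 1 ≤ m → 0 < σ m
  mono : MonoFrom1 σ
  dual_mono : DualMonoFrom1 σ
  dini : ∀ m : ℕ, 1 ≤ m → (1 / C) * (σ m / (m : ℝ)) ≤ σ m - σ (m - 1)

/-- The reciprocal `σ m / m` of the dual sequence, extended to `0` by its value at `1`. -/
def invDual (σ : ℕ → ℝ) (m : ℕ) : ℝ := if m = 0 then σ 1 else σ m / m

section Weights

variable {σ : ℕ → ℝ} {C : ℝ}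

lemma IsWeight.monotone (h : IsWeight σ C) : Monotone σ := by
  refine monotone_nat_of_le_succ fun n => ?_
  rcases Nat.eq_zero_or_pos n with rfl | hn
  · rw [h.zero]; exact (h.pos 1 le_rfl).le
  · exact h.mono n hn

lemma IsWeight.mul_invDual (h : IsWeight σ C) (m : ℕ) : m * invDual σ m = σ m := by
  unfold invDual
  split_ifs with hm
  · simp [hm, h.zero]
  · field_simp

lemma IsWeight.invDual_pos (h : IsWeight σ C) (m : ℕ) : 0 < invDual σ m := by
  unfold invDual
  split_ifs with hm
  · exact h.pos 1 le_rfl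
  · have := h.pos m (by omega)
    positivity

lemma IsWeight.invDual_antitone (h : IsWeight σ C) : Antitone (invDual σ) := by
  refine antitone_nat_of_succ_le fun n => ?_
  rcases Nat.eq_zero_or_pos n with rfl | hn
  · simp [invDual]
  · have h1 := h.dual_mono n hn
    have h2 := h.pos n hn
    have h3 := h.pos (n + 1) (by omega)
    have hn0 : (0 : ℝ) < n := by exact_mod_cast hn
    simp only [invDual, Nat.add_eq_zero_iff, one_ne_zero, and_false, if_false, hn.ne']
    rw [div_le_div_iff₀ h2 h3] at h1
    push_cast
    rw [div_le_div_iff₀ (by positivity) hn0]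
    linarith

lemma IsWeight.invDual_succ_le (h : IsWeight σ C) (m : ℕ) :
    (1 / C) * invDual σ (m + 1) ≤ σ (m + 1) - σ m := by
  simpa [invDual] using h.dini (m + 1) (by omega)

lemma IsWeight.invDual_le_two_mul (h : IsWeight σ C) (m : ℕ) :
    invDual σ m ≤ 2 * invDual σ (m + 1) := by
  have hp := h.invDual_pos (m + 1)
  rcases Nat.eq_zero_or_pos m with rfl | hm
  · have : invDual σ 0 = invDual σ (0 + 1) := by simp [invDual]
    linarith
  · have h1 := h.mul_invDual m
    have h2 := h.mul_invDual (m + 1)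
    have h3 := h.mono m hm
    have hm0 : (1 : ℝ) ≤ m := by exact_mod_cast hm
    push_cast at h2
    by_contra! hlt
    nlinarith

lemma GoodDiniReg.exists_isWeight {τ : ℕ → ℝ} (h : GoodDiniReg σ τ) : ∃ C, IsWeight σ C := by
  obtain ⟨⟨h0, ⟨C, hC, hd⟩, -⟩, hpos, hm, hdm⟩ := h
  exact ⟨C, h0, hC, hpos, hm, hdm, fun m hm => (hd m hm).1⟩

/-- The pairing of a nonnegative sequence `a` with the functional which is constant on `D`,
with the fundamental weight, and given by `g` on `S`. -/
def weightVal (σ : ℕ → ℝ) (D S : Finset ℕ) (g a : ℕ → ℝ) : ℝ :=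
  invDual σ D.card * ∑ n ∈ D, a n + ∑ n ∈ S, g n * a n

end Weights

section Renorming

variable {𝕜 : Type*} [RCLike 𝕜] {X : Type*} [NormedAddCommGroup X] [NormedSpace 𝕜 X]
  {x : ℕ → X} {xs : ℕ → X →L[𝕜] 𝕜} {σ : ℕ → ℝ} {c δ C : ℝ}

/-- The admissible pairs: `g` is small in the dual norm after every order-preserving relabelling,
and pointwise small compared to the weight of `D`. -/
structure Admissible (xs : ℕ → X →L[𝕜] 𝕜) (σ : ℕ → ℝ) (c δ : ℝ) (D S : Finset ℕ)
    (g : ℕ → ℝ) : Prop where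
  disj : Disjoint D S
  nonneg : ∀ n ∈ S, 0 ≤ g n
  le : ∀ n ∈ S, g n ≤ c * invDual σ D.card
  sum_le : ∀ (A : Finset ℕ) (α β : ℕ → ℕ), StrictMonoOn α A → StrictMonoOn β A →
    (∀ i ∈ A, α i ∈ S) → ∀ f, ∑ i ∈ A, g (α i) * ‖xs (β i) f‖ ≤ δ * ‖f‖

/-- The new norm. -/
def renorm (xs : ℕ → X →L[𝕜] 𝕜) (σ : ℕ → ℝ) (c δ : ℝ) (f : X) : ℝ :=
  sSup {r : ℝ | ∃ (D S : Finset ℕ) (g : ℕ → ℝ), Admissible xs σ c δ D S g ∧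
    r = weightVal σ D S g (fun n => ‖xs n f‖)}

lemma admissible_empty_right (hδ : 0 ≤ δ) (D : Finset ℕ) :
    Admissible xs σ c δ D ∅ (fun _ => 0) where
  disj := by simp
  nonneg := by simp
  le := by simp
  sum_le A α β _ _ _ f := by simpa using mul_nonneg hδ (norm_nonneg f)

lemma weightVal_nonneg (hσ : IsWeight σ C) {D S : Finset ℕ} {g a : ℕ → ℝ}
    (had : Admissible xs σ c δ D S g) (ha : ∀ n, 0 ≤ a n) : 0 ≤ weightVal σ D S g a :=
  add_nonneg (mul_nonneg (hσ.invDual_pos _).le (Finset.sum_nonneg fun n _ => ha n))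
    (Finset.sum_nonneg fun n hn => mul_nonneg (had.nonneg n hn) (ha n))

lemma weightVal_mono (hσ : IsWeight σ C) {D S : Finset ℕ} {g a b : ℕ → ℝ}
    (had : Admissible xs σ c δ D S g) (hab : ∀ n, a n ≤ b n) :
    weightVal σ D S g a ≤ weightVal σ D S g b :=
  add_le_add (mul_le_mul_of_nonneg_left (Finset.sum_le_sum fun n _ => hab n)
    (hσ.invDual_pos _).le)
    (Finset.sum_le_sum fun n hn => mul_le_mul_of_nonneg_left (hab n) (had.nonneg n hn))

/-- Shrinking both sets of an admissible pair, and `g`. -/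
lemma Admissible.mono (hσ : IsWeight σ C) (hc : 0 ≤ c) {D S D' S' : Finset ℕ} {g : ℕ → ℝ}
    (had : Admissible xs σ c δ D S g) (hD : D'.card ≤ D.card) (hS : S' ⊆ S)
    (hdisj : Disjoint D' S') : Admissible xs σ c δ D' S' g where
  disj := hdisj
  nonneg n hn := had.nonneg n (hS hn)
  le n hn := (had.le n (hS hn)).trans (mul_le_mul_of_nonneg_left (hσ.invDual_antitone hD) hc)
  sum_le A α β hα hβ hA f := had.sum_le A α β hα hβ (fun i hi => hS (hA i hi)) f

lemma Admissible.card_filter_le (hb : IsBasis x xs) (hσ : IsWeight σ C) {K : ℝ}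
    (hK : ∀ m, 1 ≤ m → fundFun 𝕜 x m ≤ K * σ m) (hδ : 0 ≤ δ) (hδc : δ * K < c)
    {D S : Finset ℕ} {g : ℕ → ℝ} (had : Admissible xs σ c δ D S g) (d : ℕ) :
    (S.filter fun n => c * invDual σ d < g n).card ≤ d := by
  set A := S.filter fun n => c * invDual σ d < g n with hA
  by_contra! hlt
  have hA1 : 1 ≤ A.card := by omega
  have hN0 : (0 : ℝ) < A.card := by exact_mod_cast hA1
  obtain ⟨Cx, hCx⟩ := hb.norm_bdd
  have h1 := had.sum_le A id id (strictMono_id.strictMonoOn _) (strictMono_id.strictMonoOn _)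
    (fun i hi => (Finset.mem_filter.1 hi).1) (∑ n ∈ A, (1 : 𝕜) • x n)
  have h2 : A.card * (c * invDual σ d)
      ≤ ∑ i ∈ A, g (id i) * ‖xs (id i) (∑ n ∈ A, (1 : 𝕜) • x n)‖ := by
    rw [← nsmul_eq_mul]
    refine Finset.card_nsmul_le_sum _ _ _ fun n hn => ?_
    have : xs n (∑ n ∈ A, (1 : 𝕜) • x n) = 1 := by
      rw [hb.coord_sum A (fun _ => 1), if_pos hn]
    simp only [id, this, norm_one, mul_one]
    exact (Finset.mem_filter.1 hn).2.le
  have h3 := le_fundFun (𝕜 := 𝕜) hCx (A := A) (ε := fun _ => 1) le_rfl (by simp)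
  have h4 := hK _ hA1
  rw [← hσ.mul_invDual] at h4
  have h5 := hσ.invDual_antitone hlt.le
  have h6 := hσ.invDual_pos d
  have h7 := hσ.invDual_pos A.card
  have h8 : A.card * (c * invDual σ d) ≤ δ * (K * (A.card * invDual σ A.card)) :=
    h2.trans (h1.trans (mul_le_mul_of_nonneg_left (h3.trans h4) hδ))
  have h9 : A.card * (c * invDual σ d) ≤ A.card * (δ * K * invDual σ A.card) := by linarith
  have h10 := le_of_mul_le_mul_left h9 hN0
  have hc0 : 0 < c := by
    by_contra! hcle
    have hK0 : 0 < K := by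
      have := fundFun_pos (𝕜 := 𝕜) hb.norm_pos.choose_spec.1 hb.norm_pos.choose_spec.2 hCx hA1
      have h12 := hK _ hA1
      have h13 := hσ.pos _ hA1
      by_contra! hK0
      nlinarith
    nlinarith
  nlinarith

/-- Adding to `D` an index where `a` is maximal does not decrease the value. -/
lemma Admissible.exists_insert (hσ : IsWeight σ C) (hc0 : 0 ≤ c) (hc : 4 * c ≤ 1 / C)
    {D S : Finset ℕ} {g : ℕ → ℝ} (had : Admissible xs σ c δ D S g)
    (hcard : (S.filter fun n => c * invDual σ (D.card + 1) < g n).card ≤ D.card + 1)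
    {j : ℕ} (hj : j ∉ D) {a : ℕ → ℝ} {s : ℝ} (ha0 : ∀ n, 0 ≤ a n) (has : ∀ n, a n ≤ s)
    (haj : a j = s) :
    ∃ S' g', Admissible xs σ c δ (insert j D) S' g' ∧
      weightVal σ D S g a ≤ weightVal σ (insert j D) S' g' a := by
  classical
  have hs0 : 0 ≤ s := (ha0 j).trans (has j)
  set κ := c * invDual σ (D.card + 1) with hκ
  have hκ0 : 0 ≤ κ := mul_nonneg hc0 (hσ.invDual_pos _).le
  have hcardI : (insert j D).card = D.card + 1 := Finset.card_insert_of_notMem hj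
  refine ⟨S.erase j, fun n => min (g n) κ, ⟨?_, fun n hn => ?_, fun n hn => ?_, ?_⟩, ?_⟩
  · rw [Finset.disjoint_insert_left]
    exact ⟨Finset.notMem_erase j S, had.disj.mono_right (Finset.erase_subset _ _)⟩
  · exact le_min (had.nonneg n (Finset.mem_of_mem_erase hn)) hκ0
  · rw [hcardI]; exact min_le_right _ _
  · intro A α β hα hβ hA f
    refine le_trans (Finset.sum_le_sum fun i _ => ?_)
      (had.sum_le A α β hα hβ (fun i hi => Finset.mem_of_mem_erase (hA i hi)) f)
    exact mul_le_mul_of_nonneg_right (min_le_left _ _) (norm_nonneg _)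
  · unfold weightVal
    rw [hcardI, Finset.sum_insert hj, haj]
    set ρ := invDual σ D.card with hρ
    set ρ' := invDual σ (D.card + 1) with hρ'
    have hρ0 : 0 < ρ := hσ.invDual_pos _
    have hρρ : ρ' ≤ ρ := hσ.invDual_antitone (Nat.le_succ _)
    have hρ2 : ρ ≤ 2 * ρ' := hσ.invDual_le_two_mul _
    have hDs : ∑ n ∈ D, a n ≤ D.card * s := by
      rw [← nsmul_eq_mul]
      exact Finset.sum_le_card_nsmul _ _ _ fun n _ => has n
    have hdini : (1 / C) * ρ' ≤ (D.card + 1) * ρ' - D.card * ρ := by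
      have h1 := hσ.invDual_succ_le D.card
      rw [← hσ.mul_invDual, ← hσ.mul_invDual D.card] at h1
      push_cast at h1
      exact h1
    have hgain : s * ((1 / C) * ρ') ≤ ρ' * (s + ∑ n ∈ D, a n) - ρ * ∑ n ∈ D, a n := by
      nlinarith
    have herase : ∑ n ∈ S, g n * a n ≤ c * ρ * s + ∑ n ∈ S.erase j, g n * a n := by
      by_cases hjS : j ∈ S
      · rw [← Finset.add_sum_erase S _ hjS, haj]
        have := mul_le_mul_of_nonneg_right (had.le j hjS) hs0
        linarith
      · rw [Finset.erase_eq_of_notMem hjS]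
        have : 0 ≤ c * ρ * s := by positivity
        linarith
    have htrunc : ∑ n ∈ S.erase j, g n * a n
        ≤ ∑ n ∈ S.erase j, min (g n) κ * a n + (D.card + 1) * ((c * ρ - κ) * s) := by
      have hκρ : 0 ≤ c * ρ - κ := by
        rw [hκ, ← mul_sub]; exact mul_nonneg hc0 (by linarith)
      have h1 : ∑ n ∈ S.erase j, (g n * a n - min (g n) κ * a n)
          ≤ ∑ n ∈ (S.erase j).filter (fun n => κ < g n), (c * ρ - κ) * s := by
        rw [Finset.sum_filter]
        refine Finset.sum_le_sum fun n hn => ?_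
        have hle := had.le n (Finset.mem_of_mem_erase hn)
        split_ifs with h
        · rw [min_eq_right h.le, ← sub_mul]
          exact mul_le_mul (by linarith) (has n) (ha0 n) hκρ
        · rw [min_eq_left (not_lt.1 h)]; simp
      have h2 : (((S.erase j).filter (fun n => κ < g n)).card : ℝ) ≤ D.card + 1 := by
        have := (Finset.card_le_card (Finset.filter_subset_filter (fun n => κ < g n)
          (Finset.erase_subset j S))).trans hcard
        exact_mod_cast this
      rw [Finset.sum_sub_distrib, Finset.sum_const, nsmul_eq_mul] at h1
      have h3 := mul_le_mul_of_nonneg_right h2 (mul_nonneg hκρ hs0)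
      linarith
    have hloss : (D.card + 1) * ((c * ρ - κ) * s) ≤ c * ρ * s := by
      have hσσ := hσ.monotone (Nat.le_succ D.card)
      rw [← hσ.mul_invDual, ← hσ.mul_invDual D.card.succ] at hσσ
      push_cast [Nat.succ_eq_add_one] at hσσ
      have : (D.card + 1) * ((c * ρ - κ) * s) = c * s * ((D.card + 1) * (ρ - ρ')) := by
        rw [hκ]; ring
      rw [this]
      have h1 : (D.card + 1) * (ρ - ρ') ≤ ρ := by linarith
      calc _ ≤ c * s * ρ := mul_le_mul_of_nonneg_left h1 (mul_nonneg hc0 hs0)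
        _ = _ := by ring
    have hfin : 2 * (c * ρ * s) ≤ s * ((1 / C) * ρ') := by
      have hρ'0 : 0 < ρ' := hσ.invDual_pos _
      have h1 : c * ρ ≤ c * (2 * ρ') := mul_le_mul_of_nonneg_left hρ2 hc0
      have h2 : 4 * c * ρ' ≤ (1 / C) * ρ' := mul_le_mul_of_nonneg_right hc hρ'0.le
      nlinarith
    linarith

/-- The parameters of the new norm are small enough. -/
structure SmallParams (𝕜 : Type*) [RCLike 𝕜] {X : Type*} [NormedAddCommGroup X]
    [NormedSpace 𝕜 X] (x : ℕ → X) (σ : ℕ → ℝ) (C c δ K : ℝ) : Prop where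
  weight : IsWeight σ C
  c_pos : 0 < c
  c_le : 4 * c ≤ 1 / C
  δ_pos : 0 < δ
  δ_lt : δ * K < c
  fundFun_le : ∀ m, 1 ≤ m → fundFun 𝕜 x m ≤ K * σ m

variable {K : ℝ}

lemma Admissible.exists_superset (hb : IsBasis x xs) (hp : SmallParams 𝕜 x σ C c δ K)
    {D S : Finset ℕ} {g : ℕ → ℝ} (had : Admissible xs σ c δ D S g) (A : Finset ℕ)
    {a : ℕ → ℝ} {s : ℝ} (ha0 : ∀ n, 0 ≤ a n) (has : ∀ n, a n ≤ s) (haA : ∀ n ∈ A, a n = s) :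
    ∃ D' S' g', A ⊆ D' ∧ Admissible xs σ c δ D' S' g' ∧
      weightVal σ D S g a ≤ weightVal σ D' S' g' a := by
  classical
  induction A using Finset.induction_on with
  | empty => exact ⟨D, S, g, by simp, had, le_rfl⟩
  | insert j A _ ih =>
    obtain ⟨D', S', g', hA, had', hle⟩ := ih fun n hn => haA n (Finset.mem_insert_of_mem hn)
    by_cases hj : j ∈ D'
    · exact ⟨D', S', g', Finset.insert_subset hj hA, had', hle⟩
    · obtain ⟨S'', g'', had'', hle'⟩ := had'.exists_insert hp.weight hp.c_pos.le hp.c_le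
        (had'.card_filter_le hb hp.weight hp.fundFun_le hp.δ_pos.le hp.δ_lt _) hj ha0 has
        (haA j (Finset.mem_insert_self j A))
      exact ⟨insert j D', S'', g'', Finset.insert_subset_insert j hA, had'', hle.trans hle'⟩

/-- A form of Property (A) for the new norm. -/
lemma Admissible.exists_swap (hb : IsBasis x xs) (hp : SmallParams 𝕜 x σ C c δ K)
    {D S : Finset ℕ} {g : ℕ → ℝ} (had : Admissible xs σ c δ D S g) {A B : Finset ℕ}
    (hAB : Disjoint A B) (hcard : A.card ≤ B.card) {a b : ℕ → ℝ} {s : ℝ}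
    (ha0 : ∀ n, 0 ≤ a n) (has : ∀ n, a n ≤ s) (haB : ∀ n ∈ B, a n = 0)
    (hbB : ∀ n ∈ B, s ≤ b n) (hab : ∀ n, n ∉ A → a n ≤ b n) :
    ∃ D' S' g', Admissible xs σ c δ D' S' g' ∧
      weightVal σ D S g a ≤ weightVal σ D' S' g' b := by
  classical
  have hs0 : 0 ≤ s := (ha0 0).trans (has 0)
  set a' : ℕ → ℝ := fun n => if n ∈ A then s else a n with ha'
  have ha'A : ∀ n ∈ A, a' n = s := fun n hn => by simp [ha', hn]
  have ha'n : ∀ n, n ∉ A → a' n = a n := fun n hn => by simp [ha', hn]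
  have ha'B : ∀ n ∈ B, a' n = 0 := fun n hn => by
    rw [ha'n n (Finset.disjoint_right.1 hAB hn), haB n hn]
  have haa' : ∀ n, a n ≤ a' n := fun n => by
    by_cases h : n ∈ A
    · rw [ha'A n h]; exact has n
    · rw [ha'n n h]
  obtain ⟨D', S', g', hAD, had', hle⟩ := had.exists_superset hb hp A
    (a := a') (s := s) (fun n => (ha0 n).trans (haa' n))
    (fun n => by
      by_cases h : n ∈ A
      · rw [ha'A n h]
      · rw [ha'n n h]; exact has n) ha'A
  obtain ⟨B₀, hB₀, hB₀c⟩ := Finset.exists_subset_card_eq hcard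
  set D₁ := D' \ (A ∪ B) with hD₁
  have hD₁d : Disjoint D₁ B₀ := Finset.disjoint_left.2 fun n h1 h2 => by
    simp only [hD₁, Finset.mem_sdiff, Finset.mem_union, not_or] at h1
    exact h1.2.2 (hB₀ h2)
  have hD₁A : Disjoint D₁ A := Finset.disjoint_left.2 fun n h1 h2 => by
    simp only [hD₁, Finset.mem_sdiff, Finset.mem_union, not_or] at h1
    exact h1.2.1 h2
  have hc1 : (D₁ ∪ B₀).card ≤ D'.card := by
    rw [Finset.card_union_of_disjoint hD₁d, hB₀c, ← Finset.card_union_of_disjoint hD₁A]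
    exact Finset.card_le_card (Finset.union_subset Finset.sdiff_subset hAD)
  have had'' : Admissible xs σ c δ (D₁ ∪ B₀) (S' \ B) g' := by
    refine had'.mono hp.weight hp.c_pos.le hc1 Finset.sdiff_subset ?_
    rw [Finset.disjoint_union_left]
    exact ⟨had'.disj.mono Finset.sdiff_subset Finset.sdiff_subset,
      Finset.disjoint_left.2 fun n h1 h2 => (Finset.mem_sdiff.1 h2).2 (hB₀ h1)⟩
  refine ⟨D₁ ∪ B₀, S' \ B, g', had'',
    (weightVal_mono hp.weight had haa').trans (hle.trans ?_)⟩
  have hb1 : ∀ n ∈ D₁, a' n ≤ b n := fun n hn => by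
    have := Finset.disjoint_left.1 hD₁A hn
    rw [ha'n n this]
    exact hab n this
  have hsum1 : ∑ n ∈ D', a' n ≤ ∑ n ∈ D₁ ∪ B₀, b n := by
    have h1 : ∑ n ∈ D', a' n = ∑ n ∈ D₁ ∪ A, a' n := by
      symm
      refine Finset.sum_subset (Finset.union_subset Finset.sdiff_subset hAD) fun n hn hn' => ?_
      simp only [hD₁, Finset.mem_union, Finset.mem_sdiff, not_or, not_and, not_not] at hn'
      refine ha'B n ?_
      by_contra hnB
      exact hnB (hn'.1 hn hn'.2)
    rw [h1, Finset.sum_union hD₁A, Finset.sum_union hD₁d]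
    refine add_le_add (Finset.sum_le_sum hb1) ?_
    rw [Finset.sum_congr rfl ha'A, Finset.sum_const, ← hB₀c]
    exact Finset.card_nsmul_le_sum _ _ _ fun n hn => hbB n (hB₀ hn)
  have hsum2 : ∑ n ∈ S', g' n * a' n ≤ ∑ n ∈ S' \ B, g' n * b n := by
    have h1 : ∑ n ∈ S', g' n * a' n = ∑ n ∈ S' \ B, g' n * a' n := by
      symm
      refine Finset.sum_subset Finset.sdiff_subset fun n hn hn' => ?_
      rw [ha'B n (by simpa [hn] using hn'), mul_zero]
    rw [h1]
    refine Finset.sum_le_sum fun n hn => mul_le_mul_of_nonneg_left ?_ (had''.nonneg n hn)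
    have hnA : n ∉ A := fun h =>
      Finset.disjoint_left.1 had'.disj (hAD h) (Finset.mem_sdiff.1 hn).1
    rw [ha'n n hnA]
    exact hab n hnA
  exact add_le_add (mul_le_mul (hp.weight.invDual_antitone hc1) hsum1
    (Finset.sum_nonneg fun n _ => (ha0 n).trans (haa' n)) (hp.weight.invDual_pos _).le) hsum2

lemma weightVal_le (hb : IsBasis x xs) {M : ℝ} (hM : 1 ≤ M)
    (hss : SubsymWith 𝕜 (fun f : X => ‖f‖) x M) (hσ : IsWeight σ C) {L : ℝ}
    (hL0 : 0 ≤ L) (hL : ∀ m, 1 ≤ m → σ m ≤ L * fundFun 𝕜 x m) {D S : Finset ℕ} {g : ℕ → ℝ}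
    (had : Admissible xs σ c δ D S g) (f : X) :
    weightVal σ D S g (fun n => ‖xs n f‖) ≤ (L * (2 * M ^ 6) + δ) * ‖f‖ := by
  have h1 : ∑ n ∈ S, g n * ‖xs n f‖ ≤ δ * ‖f‖ := had.sum_le S id id
    (strictMono_id.strictMonoOn _) (strictMono_id.strictMonoOn _) (fun i hi => hi) f
  have h2 : invDual σ D.card * ∑ n ∈ D, ‖xs n f‖ ≤ L * (2 * M ^ 6) * ‖f‖ := by
    rcases Nat.eq_zero_or_pos D.card with h0 | hpos
    · rw [Finset.card_eq_zero.1 h0]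
      simp only [Finset.sum_empty, mul_zero]
      positivity
    · have h3 := hb.sum_norm_coord_mul_fundFun_le hM hss D f
      have hD0 : (0 : ℝ) < D.card := by exact_mod_cast hpos
      have h4 := hL _ hpos
      rw [← hσ.mul_invDual] at h4
      have hS0 : 0 ≤ ∑ n ∈ D, ‖xs n f‖ := Finset.sum_nonneg fun _ _ => norm_nonneg _
      refine le_of_mul_le_mul_left ?_ hD0
      calc _ = (D.card * invDual σ D.card) * ∑ n ∈ D, ‖xs n f‖ := by ring
        _ ≤ (L * fundFun 𝕜 x D.card) * ∑ n ∈ D, ‖xs n f‖ := mul_le_mul_of_nonneg_right h4 hS0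
        _ = L * ((∑ n ∈ D, ‖xs n f‖) * fundFun 𝕜 x D.card) := by ring
        _ ≤ L * (2 * M ^ 6 * D.card * ‖f‖) := mul_le_mul_of_nonneg_left h3 hL0
        _ = _ := by ring
  calc _ ≤ L * (2 * M ^ 6) * ‖f‖ + δ * ‖f‖ := add_le_add h2 h1
    _ = _ := by ring

lemma renorm_le (hδ : 0 ≤ δ) {f : X} {b : ℝ}
    (h : ∀ D S g, Admissible xs σ c δ D S g → weightVal σ D S g (fun n => ‖xs n f‖) ≤ b) :
    renorm xs σ c δ f ≤ b := by
  refine csSup_le ⟨_, ∅, ∅, _, admissible_empty_right hδ ∅, rfl⟩ ?_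
  rintro r ⟨D, S, g, had, rfl⟩
  exact h D S g had

/-- The admissible functionals are bounded by a multiple of the original norm. -/
def BoundedBy (xs : ℕ → X →L[𝕜] 𝕜) (σ : ℕ → ℝ) (c δ U : ℝ) : Prop :=
  ∀ D S g, Admissible xs σ c δ D S g → ∀ f : X,
    weightVal σ D S g (fun n => ‖xs n f‖) ≤ U * ‖f‖

variable {U : ℝ}

lemma le_renorm (hU : BoundedBy xs σ c δ U) {D S : Finset ℕ} {g : ℕ → ℝ}
    (had : Admissible xs σ c δ D S g) (f : X) :
    weightVal σ D S g (fun n => ‖xs n f‖) ≤ renorm xs σ c δ f := by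
  refine le_csSup ⟨U * ‖f‖, ?_⟩ ⟨D, S, g, had, rfl⟩
  rintro r ⟨D', S', g', had', rfl⟩
  exact hU D' S' g' had' f

lemma renorm_le_renorm (hδ : 0 ≤ δ) (hU : BoundedBy xs σ c δ U) {f h : X}
    (H : ∀ D S g, Admissible xs σ c δ D S g → ∃ D' S' g', Admissible xs σ c δ D' S' g' ∧
      weightVal σ D S g (fun n => ‖xs n f‖) ≤ weightVal σ D' S' g' (fun n => ‖xs n h‖)) :
    renorm xs σ c δ f ≤ renorm xs σ c δ h :=
  renorm_le hδ fun D S g had => by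
    obtain ⟨D', S', g', had', hle⟩ := H D S g had
    exact hle.trans (le_renorm hU had' h)

lemma renorm_add_le (hσ : IsWeight σ C) (hδ : 0 ≤ δ) (hU : BoundedBy xs σ c δ U) (f h : X) :
    renorm xs σ c δ (f + h) ≤ renorm xs σ c δ f + renorm xs σ c δ h :=
  renorm_le hδ fun D S g had => by
    refine le_trans ?_ (add_le_add (le_renorm hU had f) (le_renorm hU had h))
    refine (weightVal_mono hσ had (b := fun n => ‖xs n f‖ + ‖xs n h‖)
      fun n => by rw [map_add]; exact norm_add_le _ _).trans (le_of_eq ?_)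
    simp only [weightVal, mul_add, Finset.sum_add_distrib]
    ring

lemma renorm_smul_le (hδ : 0 ≤ δ) (hU : BoundedBy xs σ c δ U) (a : 𝕜) (f : X) :
    renorm xs σ c δ (a • f) ≤ ‖a‖ * renorm xs σ c δ f :=
  renorm_le hδ fun D S g had => by
    refine le_trans (le_of_eq ?_)
      (mul_le_mul_of_nonneg_left (le_renorm hU had f) (norm_nonneg a))
    simp only [weightVal, map_smul, smul_eq_mul, norm_mul, mul_add, Finset.mul_sum]
    congr 1 <;> exact Finset.sum_congr rfl fun _ _ => by ring

lemma renorm_nonneg (hδ : 0 ≤ δ) (hU : BoundedBy xs σ c δ U) (f : X) :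
    0 ≤ renorm xs σ c δ f := by
  have h := le_renorm hU (admissible_empty_right hδ ∅) f
  simpa [weightVal] using h

lemma renorm_smul (hδ : 0 ≤ δ) (hU : BoundedBy xs σ c δ U) (a : 𝕜) (f : X) :
    renorm xs σ c δ (a • f) = ‖a‖ * renorm xs σ c δ f := by
  refine le_antisymm (renorm_smul_le hδ hU a f) ?_
  by_cases ha : a = 0
  · simpa [ha] using renorm_nonneg hδ hU (0 : X)
  · have h := renorm_smul_le hδ hU a⁻¹ (a • f)
    rwa [smul_smul, inv_mul_cancel₀ ha, one_smul, norm_inv, ← div_eq_inv_mul,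
      le_div_iff₀ (norm_pos_iff.2 ha), mul_comm] at h

lemma renorm_lower_bound (hb : IsBasis x xs) {M : ℝ} (hM : 1 ≤ M)
    (hss : SubsymWith 𝕜 (fun f : X => ‖f‖) x M) (hσ : IsWeight σ C) (hc : 0 < c) (hδ : 0 < δ)
    (hU0 : 0 ≤ U) (hU : BoundedBy xs σ c δ U) :
    ∃ b : ℝ, 0 < b ∧ ∀ f : X, b * ‖f‖ ≤ renorm xs σ c δ f := by
  obtain ⟨B, hB⟩ := hb.norm_bdd
  have hB1 : 0 < max B 1 := lt_max_of_lt_right one_pos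
  have hσ1 := hσ.pos 1 le_rfl
  have hM0 : 0 < M := by linarith
  set t := min (δ / M ^ 3) (c * σ 1 / max B 1) with ht
  have ht0 : 0 < t := lt_min (by positivity) (by positivity)
  have ht1 : t * M ^ 3 ≤ δ := (le_div_iff₀ (by positivity)).1 (min_le_left _ _)
  have ht2 : t * max B 1 ≤ c * σ 1 := (le_div_iff₀ hB1).1 (min_le_right _ _)
  have hspan : ∀ f ∈ Submodule.span 𝕜 (Set.range x), t * ‖f‖ ≤ renorm xs σ c δ f := by
    intro f hf
    obtain ⟨l, hl⟩ := Finsupp.mem_span_range_iff_exists_finsupp.1 hf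
    obtain ⟨F, hF, hFf⟩ := exists_dual_vector'' 𝕜 f
    have had : Admissible xs σ c δ ∅ l.support (fun n => t * ‖F (x n)‖) := by
      refine ⟨by simp, fun n _ => by positivity, fun n _ => ?_, fun A α β hα hβ _ h => ?_⟩
      · have h1 : ‖F (x n)‖ ≤ max B 1 := by
          have := F.le_of_opNorm_le hF (x n)
          rw [one_mul] at this
          exact this.trans ((hB n).trans (le_max_left _ _))
        simp only [Finset.card_empty, invDual, if_true]
        exact (mul_le_mul_of_nonneg_left h1 ht0.le).trans ht2
      · have h1 := hb.sum_norm_mul_norm_coord_le hM hss hα hβ F hF h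
        calc _ = t * ∑ i ∈ A, ‖F (x (α i))‖ * ‖xs (β i) h‖ := by
              rw [Finset.mul_sum]
              exact Finset.sum_congr rfl fun _ _ => by ring
          _ ≤ t * (M ^ 3 * ‖h‖) := mul_le_mul_of_nonneg_left h1 ht0.le
          _ = t * M ^ 3 * ‖h‖ := by ring
          _ ≤ _ := mul_le_mul_of_nonneg_right ht1 (norm_nonneg _)
    refine le_trans ?_ (le_renorm hU had f)
    have hf' : f = ∑ n ∈ l.support, l n • x n := hl.symm
    have hcoord : ∀ n ∈ l.support, xs n f = l n := fun n hn => by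
      rw [hf', hb.coord_sum, if_pos hn]
    have h2 : ‖f‖ ≤ ∑ n ∈ l.support, ‖F (x n)‖ * ‖xs n f‖ := by
      have h3 : F f = ∑ n ∈ l.support, l n * F (x n) := by
        conv_lhs => rw [hf']
        simp
      have h4 : ‖F f‖ = ‖f‖ := by rw [hFf, RCLike.norm_ofReal, abs_norm]
      rw [← h4, h3]
      refine norm_sum_le_of_le _ fun n hn => ?_
      rw [norm_mul, hcoord n hn, mul_comm]
    simp only [weightVal, Finset.sum_empty, mul_zero, zero_add, mul_assoc, ← Finset.mul_sum]
    exact mul_le_mul_of_nonneg_left h2 ht0.le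
  refine ⟨t, ht0, fun f => le_of_forall_pos_le_add fun ε hε => ?_⟩
  obtain ⟨h, hh, hfh⟩ := Metric.dense_iff.1 hb.dense f (ε / (t + U + 1)) (by positivity)
  rw [Metric.mem_ball, dist_comm, dist_eq_norm, lt_div_iff₀ (by positivity)] at hh
  have h1 := hspan h hfh
  have h2 := renorm_add_le hσ hδ.le hU f (h - f)
  have h3 : renorm xs σ c δ (h - f) ≤ U * ‖h - f‖ := renorm_le hδ.le fun D S g had => hU D S g had _
  have h4 : ‖f‖ ≤ ‖h‖ + ‖f - h‖ := by
    have := norm_add_le h (f - h)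
    rwa [add_sub_cancel] at this
  rw [add_sub_cancel] at h2
  rw [norm_sub_rev] at h3
  nlinarith [norm_nonneg (f - h)]

lemma renorm_sum_le (hb : IsBasis x xs) (hp : SmallParams 𝕜 x σ C c δ K) (A : Finset ℕ)
    {ε : ℕ → 𝕜} (hε : ∀ n, ‖ε n‖ = 1) :
    renorm xs σ c δ (∑ n ∈ A, ε n • x n) ≤ σ A.card := by
  classical
  refine renorm_le hp.δ_pos.le fun D S g had => ?_
  set a : ℕ → ℝ := fun n => ‖xs n (∑ n ∈ A, ε n • x n)‖ with ha
  have haA : ∀ n ∈ A, a n = 1 := fun n hn => by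
    simp only [ha]; rw [hb.coord_sum, if_pos hn, hε]
  have haA' : ∀ n, n ∉ A → a n = 0 := fun n hn => by
    simp only [ha]; rw [hb.coord_sum, if_neg hn, norm_zero]
  obtain ⟨D', S', g', hAD, had', hle⟩ := had.exists_superset hb hp A (a := a) (s := 1)
    (fun n => norm_nonneg _) (fun n => by
      by_cases h : n ∈ A
      · exact (haA n h).le
      · rw [haA' n h]; exact zero_le_one) haA
  refine hle.trans ?_
  have h1 : ∑ n ∈ D', a n = A.card := by
    rw [← Finset.sum_subset hAD fun n _ h => haA' n h, Finset.sum_congr rfl haA]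
    simp
  have h2 : ∑ n ∈ S', g' n * a n = 0 := Finset.sum_eq_zero fun n hn => by
    rw [haA' n fun h => Finset.disjoint_left.1 had'.disj (hAD h) hn, mul_zero]
  rw [weightVal, h1, h2, add_zero, ← hp.weight.mul_invDual A.card, mul_comm]
  exact mul_le_mul_of_nonneg_left (hp.weight.invDual_antitone (Finset.card_le_card hAD))
    (Nat.cast_nonneg _)

lemma fundFunWith_renorm (hb : IsBasis x xs) (hp : SmallParams 𝕜 x σ C c δ K)
    (hU : BoundedBy xs σ c δ U) (m : ℕ) :
    fundFunWith 𝕜 (renorm xs σ c δ) x m = σ m := by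
  have hub : ∀ r ∈ {r : ℝ | ∃ (A : Finset ℕ) (ε : ℕ → 𝕜), A.card ≤ m ∧ (∀ n, ‖ε n‖ = 1) ∧
      r = renorm xs σ c δ (∑ n ∈ A, ε n • x n)}, r ≤ σ m := by
    rintro r ⟨A, ε, hA, hε, rfl⟩
    exact (renorm_sum_le hb hp A hε).trans (hp.weight.monotone hA)
  refine le_antisymm (csSup_le ⟨_, ∅, fun _ => 1, by simp, by simp, rfl⟩ hub) ?_
  refine le_trans ?_ (le_csSup ⟨σ m, hub⟩ ⟨Finset.range m, fun _ => 1, by simp, by simp, rfl⟩)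
  refine le_trans (le_of_eq ?_)
    (le_renorm hU (admissible_empty_right hp.δ_pos.le (Finset.range m)) _)
  have h1 : ∀ n ∈ Finset.range m, ‖xs n (∑ k ∈ Finset.range m, (1 : 𝕜) • x k)‖ = 1 := fun n hn => by
    rw [hb.coord_sum _ (fun _ => 1), if_pos hn, norm_one]
  rw [weightVal, Finset.sum_congr rfl h1]
  simp [mul_comm _ (m : ℝ), hp.weight.mul_invDual]

lemma bidemocraticWith_renorm (hb : IsBasis x xs) (hp : SmallParams 𝕜 x σ C c δ K)
    (hU : BoundedBy xs σ c δ U) : BidemocraticWith (renorm xs σ c δ) x xs 1 := by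
  intro A B ε η hε hη
  have hσ := hp.weight
  have h1 := renorm_sum_le hb hp A hε
  have h1' : 0 ≤ renorm xs σ c δ (∑ n ∈ A, ε n • x n) := renorm_nonneg hp.δ_pos.le hU _
  have hρ := hσ.invDual_pos B.card
  have h2 : dualNormWith (renorm xs σ c δ) (∑ n ∈ B, η n • xs n) ≤ 1 / invDual σ B.card := by
    refine csSup_le ⟨_, 0, ?_, rfl⟩ ?_
    · have := renorm_smul hp.δ_pos.le hU 0 (0 : X)
      rw [zero_smul, norm_zero, zero_mul] at this
      rw [this]; exact zero_le_one
    · rintro r ⟨f, hf, rfl⟩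
      have h3 := le_renorm hU (admissible_empty_right hp.δ_pos.le B) f
      simp only [weightVal, Finset.sum_empty, add_zero] at h3
      have h4 : ‖(∑ n ∈ B, η n • xs n) f‖ ≤ ∑ n ∈ B, ‖xs n f‖ := by
        rw [sum_apply]
        exact norm_sum_le_of_le _ fun n _ => by simp [hη]
      rw [le_div_iff₀ hρ]
      nlinarith
  have h5 : σ A.card * (1 / invDual σ B.card) ≤ (max A.card B.card : ℕ) := by
    rw [mul_one_div, div_le_iff₀ hρ]
    rcases le_total A.card B.card with h | h
    · rw [max_eq_right h, hσ.mul_invDual]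
      exact hσ.monotone h
    · rw [max_eq_left h, ← hσ.mul_invDual A.card]
      exact mul_le_mul_of_nonneg_left (hσ.invDual_antitone h) (Nat.cast_nonneg _)
  rw [one_mul]
  refine le_trans ?_ h5
  exact (mul_le_mul_of_nonneg_left h2 h1').trans
    (mul_le_mul_of_nonneg_right h1 (by positivity))

lemma greedyWith_renorm (hb : IsBasis x xs) (hp : SmallParams 𝕜 x σ C c δ K)
    (hU : BoundedBy xs σ c δ U) : GreedyWith (renorm xs σ c δ) x xs 1 := by
  classical
  intro f A B v hA hcard
  rw [one_mul]
  rcases A.eq_empty_or_nonempty with rfl | hne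
  · have : B = ∅ := by simpa using hcard
    simp [greedyProj, this]
  obtain ⟨n₀, hn₀, hmin⟩ := Finset.exists_min_image A (fun n => ‖xs n f‖) hne
  have hcf : ∀ n, xs n (f - greedyProj x xs A f) = if n ∈ A then 0 else xs n f := fun n => by
    rw [map_sub, greedyProj, hb.coord_sum]
    split_ifs <;> simp
  have hch : ∀ n, n ∉ B → xs n (f - ∑ n ∈ B, v n • x n) = xs n f := fun n hn => by
    rw [map_sub, hb.coord_sum, if_neg hn, sub_zero]
  refine renorm_le_renorm hp.δ_pos.le hU fun D S g had =>
    had.exists_swap hb hp (A := B \ A) (B := A \ B) (s := ‖xs n₀ f‖)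
      (Finset.disjoint_left.2 fun n h1 h2 => (Finset.mem_sdiff.1 h1).2 (Finset.mem_sdiff.1 h2).1)
      ?_ (fun n => norm_nonneg _) (fun n => ?_) (fun n hn => ?_) (fun n hn => ?_)
      (fun n hn => ?_)
  · exact (Finset.card_sdiff_le_card_sdiff_iff).2 hcard
  · rw [hcf]
    split_ifs with h
    · simp
    · exact hA n₀ hn₀ n h
  · rw [hcf, if_pos (Finset.mem_sdiff.1 hn).1, norm_zero]
  · rw [hch n (Finset.mem_sdiff.1 hn).2]
    exact hmin n (Finset.mem_sdiff.1 hn).1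
  · rw [hcf]
    split_ifs with h
    · simp
    · rw [hch n fun hB => hn (Finset.mem_sdiff.2 ⟨hB, h⟩)]

lemma subsymWith_renorm (hb : IsBasis x xs) {M : ℝ}
    (hss : SubsymWith 𝕜 (fun f : X => ‖f‖) x M) (hσ : IsWeight σ C) (hc : 0 ≤ c) (hδ : 0 ≤ δ)
    (hU : BoundedBy xs σ c δ U) : SubsymWith 𝕜 (renorm xs σ c δ) x 1 := by
  classical
  intro lam hlam β hβ
  obtain ⟨T, hT, -, -⟩ := hss lam hlam β hβ
  have hcoord : ∀ n f, ‖xs (β n) (T f)‖ = ‖xs n f‖ := fun n f => by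
    rw [hb.coord_map hβ.injective hT, norm_mul, hlam, one_mul]
  refine ⟨T, hT, fun f => ?_, fun f => ?_⟩ <;> rw [one_mul] <;>
    refine renorm_le_renorm hδ hU fun D S g had => ?_
  · have hpre : ∀ (s : Finset ℕ) (w : ℕ → ℝ), ∑ n ∈ s, w n * ‖xs n (T f)‖
        = ∑ n ∈ s.preimage β hβ.injective.injOn, w (β n) * ‖xs n f‖ := fun s w => by
      rw [← Finset.sum_preimage β s hβ.injective.injOn (fun n => w n * ‖xs n (T f)‖)
        fun n _ hn => by rw [hb.coord_map_of_notMem hT hn, norm_zero, mul_zero]]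
      exact Finset.sum_congr rfl fun n _ => by rw [hcoord]
    have hcardle : (D.preimage β hβ.injective.injOn).card ≤ D.card := by
      rw [← Finset.card_image_of_injective _ hβ.injective]
      exact Finset.card_le_card (Finset.image_subset_iff.2 fun n hn => Finset.mem_preimage.1 hn)
    refine ⟨D.preimage β hβ.injective.injOn, S.preimage β hβ.injective.injOn, fun n => g (β n),
      ⟨?_, fun n hn => had.nonneg _ (Finset.mem_preimage.1 hn), fun n hn => ?_,
        fun A α γ hα hγ hA h => ?_⟩, ?_⟩
    · exact Finset.disjoint_left.2 fun n h1 h2 => Finset.disjoint_left.1 had.disj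
        (Finset.mem_preimage.1 h1) (Finset.mem_preimage.1 h2)
    · exact (had.le _ (Finset.mem_preimage.1 hn)).trans
        (mul_le_mul_of_nonneg_left (hσ.invDual_antitone hcardle) hc)
    · exact had.sum_le A (β ∘ α) γ (hβ.comp_strictMonoOn hα) hγ
        (fun i hi => by simpa using hA i hi) h
    · have hD := hpre D (fun _ => 1)
      simp only [one_mul] at hD
      rw [weightVal, weightVal, hD, hpre S g]
      exact add_le_add_left (mul_le_mul_of_nonneg_right (hσ.invDual_antitone hcardle)
        (Finset.sum_nonneg fun _ _ => norm_nonneg _)) _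
  · have hinv : ∀ n, Function.invFun β (β n) = n := Function.leftInverse_invFun hβ.injective
    have hcardeq : (D.image β).card = D.card := Finset.card_image_of_injective _ hβ.injective
    refine ⟨D.image β, S.image β, fun n => g (Function.invFun β n),
      ⟨?_, fun n hn => ?_, fun n hn => ?_, fun A α γ hα hγ hA h => ?_⟩, ?_⟩
    · exact (Finset.disjoint_image hβ.injective).2 had.disj
    · obtain ⟨k, hk, rfl⟩ := Finset.mem_image.1 hn
      rw [hinv]
      exact had.nonneg k hk
    · obtain ⟨k, hk, rfl⟩ := Finset.mem_image.1 hn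
      rw [hinv, hcardeq]
      exact had.le k hk
    · refine had.sum_le A (fun i => Function.invFun β (α i)) γ (fun i hi j hj hij => ?_) hγ
        (fun i hi => ?_) h
      · obtain ⟨k, _, hk'⟩ := Finset.mem_image.1 (hA i hi)
        obtain ⟨l, _, hl'⟩ := Finset.mem_image.1 (hA j hj)
        have hlt := hα hi hj hij
        simp only [← hk', ← hl', hinv] at hlt ⊢
        exact hβ.lt_iff_lt.1 hlt
      · obtain ⟨k, hk, hk'⟩ := Finset.mem_image.1 (hA i hi)
        rw [← hk', hinv]
        exact hk
    · rw [weightVal, weightVal, hcardeq, Finset.sum_image hβ.injective.injOn,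
        Finset.sum_image hβ.injective.injOn]
      simp only [hcoord, hinv, le_refl]

end Renorming

/-- Theorem 5.2: a subsymmetric basis whose fundamental function has
the LRP admits a good Dini regularization `σ`, and for any such `σ` the space can be
renormed so that the basis is isometrically greedy, isometrically bidemocratic, and
isometrically subsymmetric, with fundamental function `σ`. -/
theorem subsymmetric_LRP_renorming {𝕜 : Type*} [RCLike 𝕜] {X : Type*}
    [NormedAddCommGroup X] [NormedSpace 𝕜 X] [CompleteSpace X]
    (x : ℕ → X) (xs : ℕ → X →L[𝕜] 𝕜) (hb : IsBasis x xs)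
    (hss : ∃ C : ℝ, 1 ≤ C ∧ SubsymWith 𝕜 (fun f : X => ‖f‖) x C)
    (hlrp : HasLRP (fundFun 𝕜 x)) :
    (∃ σ : ℕ → ℝ, GoodDiniReg σ (fundFun 𝕜 x)) ∧
    (∀ σ : ℕ → ℝ, GoodDiniReg σ (fundFun 𝕜 x) →
      ∃ ν : X → ℝ, IsEquivNorm 𝕜 ν ∧ GreedyWith ν x xs 1 ∧ BidemocraticWith ν x xs 1 ∧
        SubsymWith 𝕜 ν x 1 ∧
        ∀ m : ℕ, 1 ≤ m → fundFunWith 𝕜 ν x m = σ m) := by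
  obtain ⟨M, hM, hss⟩ := hss
  obtain ⟨b, hb0, hbx⟩ := hb.norm_pos
  obtain ⟨B, hB⟩ := hb.norm_bdd
  refine ⟨exists_goodDiniReg (fun m => fundFun_pos hb0 hbx hB) (fundFun_monotone hB)
    (fun m => fundFun_div_succ_le hB) hlrp, fun σ hσ => ?_⟩
  obtain ⟨C, hw⟩ := hσ.exists_isWeight
  obtain ⟨L, hL, hLσ⟩ := hσ.1.2.2
  have hL0 : 0 < L := by linarith
  have hC0 : 0 < C := by linarith [hw.one_le]
  have hp : SmallParams 𝕜 x σ C (1 / (4 * C)) (1 / (4 * C) / (2 * L)) L := by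
    refine ⟨hw, by positivity, le_of_eq (by field_simp), by positivity, ?_, fun m hm => ?_⟩
    · have h1 : 1 / (4 * C) / (2 * L) * L = 1 / (4 * C) / 2 := by field_simp
      rw [h1]
      exact half_lt_self (by positivity)
    · have h1 := (hLσ m hm).1
      rwa [one_div, inv_mul_le_iff₀ hL0] at h1
  set c := 1 / (4 * C)
  set δ := c / (2 * L)
  have hδ := hp.δ_pos
  have hU : BoundedBy xs σ c δ (L * (2 * M ^ 6) + δ) := fun D S g had =>
    weightVal_le hb hM hss hw hL0.le (fun m hm => (hLσ m hm).2) had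
  have hU0 : 0 < L * (2 * M ^ 6) + δ := by positivity
  exact ⟨renorm xs σ c δ, ⟨renorm_add_le hw hδ.le hU, renorm_smul hδ.le hU,
    renorm_lower_bound hb hM hss hw hp.c_pos hδ hU0.le hU,
    _, hU0, fun f => renorm_le hδ.le fun D S g had => hU D S g had f⟩,
    greedyWith_renorm hb hp hU, bidemocraticWith_renorm hb hp hU,
    subsymWith_renorm hb hss hw hp.c_pos.le hδ.le hU, fun m _ => fundFunWith_renorm hb hp hU m⟩

end GreedyRenorm
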